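/- If S is an idempotent semigroup (a band), then φ_t ∘ φ_s = φ_{ts} for all s, t ∈ S, and hence Cayley(S) is isomorphic to S. -/

import Mathlib

/-- φ_s([a_1,...,a_n]) = [s a_1, s a_1 a_2, ..., s a_1 ⋯ a_n] -/
def phi {S : Type*} [Mul S] (s : S) (l : List S) : List S :=
  (l.scanl (· * ·) s).tail

/-- Cayley(S): the subsemigroup of functions on words over S¹ = WithOne S
(under composition) generated by the maps φ_s, s ∈ S. -/
def Cayley (S : Type*) [Semigroup S] : Subsemigroup (Function.End (List (WithOne S))) :=
  Subsemigroup.closure {f | ∃ s : S, f = phi (s : WithOne S)}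

theorem phi_nil {S : Type*} [Mul S] (s : S) : phi s [] = [] := by
  simp [phi]

theorem phi_cons {S : Type*} [Mul S] (s a : S) (l : List S) :
    phi s (a :: l) = (s * a) :: phi (s * a) l := by
  cases l <;> simp [phi]

theorem phi_phi_of_band {S : Type*} [Semigroup S] (hband : ∀ x : S, x * x = x) (t s : S)
    (l : List S) : phi t (phi s l) = phi (t * s) l := by
  induction l generalizing s t with
  | nil => simp [phi_nil]
  | cons a l ih => simp only [phi_cons, ih, mul_assoc, hband (s * a)]

theorem WithOne.mul_self_of_band {S : Type*} [Mul S] (hband : ∀ x : S, x * x = x)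
    (x : WithOne S) : x * x = x := by
  refine WithOne.cases_on x (one_mul 1) fun a => ?_
  rw [← WithOne.coe_mul, hband]

theorem phi_injective {M : Type*} [MulOneClass M] :
    Function.Injective (phi : M → List M → List M) := by
  intro s t h
  simpa [phi_cons, phi_nil] using congrFun h [1]

/-- For a band `S`, the map `s ↦ φ_s` as a homomorphism. -/
def phiHom {S : Type*} [Semigroup S] (hband : ∀ x : S, x * x = x) :
    S →ₙ* Function.End (List (WithOne S)) where
  toFun s := phi (s : WithOne S)
  map_mul' t s := by
    funext l
    rw [WithOne.coe_mul]
    exact (phi_phi_of_band (WithOne.mul_self_of_band hband) _ _ l).symm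

theorem phiHom_injective {S : Type*} [Semigroup S] (hband : ∀ x : S, x * x = x) :
    Function.Injective (phiHom hband) :=
  phi_injective.comp WithOne.coe_injective

theorem cayley_eq_srange {S : Type*} [Semigroup S] (hband : ∀ x : S, x * x = x) :
    Cayley S = (phiHom hband).srange := by
  refine le_antisymm (Subsemigroup.closure_le.2 ?_) ?_
  · rintro _ ⟨s, rfl⟩
    exact ⟨s, rfl⟩
  · rintro _ ⟨s, rfl⟩
    exact Subsemigroup.subset_closure ⟨s, rfl⟩

/-- If S is a band (idempotent semigroup) then φ_t ∘ φ_s = φ_{ts}, and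
Cayley(S) is isomorphic to S. -/
theorem cayley_of_band {S : Type*} [Semigroup S] (hband : ∀ x : S, x * x = x) :
    (∀ s t : S, phi ((t : WithOne S)) ∘ phi ((s : WithOne S)) = phi ((↑(t * s) : WithOne S))) ∧
      Nonempty (Cayley S ≃* S) := by
  refine ⟨fun s t => ((phiHom hband).map_mul t s).symm, ?_⟩
  rw [cayley_eq_srange hband]
  refine ⟨(MulEquiv.ofBijective (phiHom hband).srangeRestrict ⟨?_, ?_⟩).symm⟩
  · intro s t h
    exact phiHom_injective hband (congrArg Subtype.val h)
  · exact (phiHom hband).srangeRestrict_surjective
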